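/- Let g := c₀·1 + c₁·e₂e₃ + c₂·e₁e₃ + c₃·e₁e₂ ∈ Cl₀,₃,₁ with c₀² + c₁² + c₂² + c₃² = 1 (a unit quaternion built on the first three generators), and let t, x ∈ ℝ⁴ have fourth coordinate zero; set τ := ι(t) and ξ := ι(x). Then the double-cover identity for proper rigid motions holds: (g + (1/2)·τ·g·e₄) · (1 + ξ·e₄) · star(g − (1/2)·τ·g·e₄) = 1 + (g·ξ·star(g) + τ)·e₄. That is, conjugating 1 + ξ·e₄ by the element g + (1/2)τge₄ of Spin(3) ⋉ ℝ³ implements the rigid motion ξ ↦ g·ξ·star(g) + τ. -/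

import Mathlib

noncomputable section

open CliffordAlgebra

/-- The degenerate quadratic form on `ℝ⁴`: `Q₄ x = -(x₀² + x₁² + x₂²)`,
the fourth coordinate contributing `0`. -/
def Q4 : QuadraticForm ℝ (Fin 4 → ℝ) :=
  QuadraticMap.weightedSumSquares ℝ (fun i : Fin 4 => if (i : ℕ) < 3 then (-1 : ℝ) else 0)

/-- The generators `eᵢ = ι(bᵢ)` of `Cl₀,₃,₁`; in particular `e₄ = e 3` squares to `0`. -/
def e (i : Fin 4) : CliffordAlgebra Q4 := ι Q4 (Pi.single i 1)

/-- Clifford conjugation: grade involution followed by reversion. -/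
def cstar (x : CliffordAlgebra Q4) : CliffordAlgebra Q4 :=
  reverse (involute x)

theorem Q4_apply (v : Fin 4 → ℝ) : Q4 v = -(v 0 ^ 2 + v 1 ^ 2 + v 2 ^ 2) := by
  simp only [Q4, QuadraticMap.weightedSumSquares_apply, Fin.sum_univ_four]
  norm_num
  ring

theorem e_mul_self (i : Fin 4) : e i * e i = algebraMap ℝ _ (if i = 3 then 0 else -1) := by
  rw [e, ι_sq_scalar, Q4_apply]
  congr 1
  fin_cases i <;> simp

theorem e_three_mul_ι (v : Fin 4 → ℝ) : e 3 * ι Q4 v = -(ι Q4 v * e 3) := by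
  rw [eq_neg_iff_add_eq_zero, e, ι_mul_ι_add_swap]
  simp [QuadraticMap.polar, Q4_apply]

theorem e_mul_e_of_ne {i j : Fin 4} (h : i ≠ j) : e i * e j = -(e j * e i) := by
  rw [eq_neg_iff_add_eq_zero, e, e, ι_mul_ι_add_swap, map_eq_zero_iff _
    (FaithfulSMul.algebraMap_injective ℝ _)]
  fin_cases i <;> fin_cases j <;> simp [QuadraticMap.polar, Q4_apply] at h ⊢

@[simp] theorem cstar_ι (v : Fin 4 → ℝ) : cstar (ι Q4 v) = -ι Q4 v := star_ι v

@[simp] theorem cstar_e (i : Fin 4) : cstar (e i) = -e i := cstar_ι _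

@[simp] theorem cstar_one : cstar 1 = 1 := star_one (CliffordAlgebra Q4)

@[simp] theorem cstar_mul (x y : CliffordAlgebra Q4) : cstar (x * y) = cstar y * cstar x :=
  star_mul x y

@[simp] theorem cstar_add (x y : CliffordAlgebra Q4) : cstar (x + y) = cstar x + cstar y :=
  star_add x y

@[simp] theorem cstar_sub (x y : CliffordAlgebra Q4) : cstar (x - y) = cstar x - cstar y :=
  star_sub x y

@[simp] theorem cstar_smul (r : ℝ) (x : CliffordAlgebra Q4) : cstar (r • x) = r • cstar x :=
  CliffordAlgebra.star_smul r x

theorem cstar_e_mul_e {i j : Fin 4} (h : i ≠ j) : cstar (e i * e j) = -(e i * e j) := by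
  rw [cstar_mul, cstar_e, cstar_e, neg_mul_neg, e_mul_e_of_ne h.symm]

theorem e_three_commute_e_mul_e {i j : Fin 4} (hi : i ≠ 3) (hj : j ≠ 3) :
    Commute (e 3) (e i * e j) := by
  rw [commute_iff_eq, ← mul_assoc, e_mul_e_of_ne hi.symm, neg_mul, mul_assoc,
    e_mul_e_of_ne hj.symm, mul_neg, neg_neg, mul_assoc]

theorem e_mul_e_sq {i j : Fin 4} (h : i ≠ j) (hi : i ≠ 3) (hj : j ≠ 3) :
    e i * e j * (e i * e j) = -1 := by
  calc e i * e j * (e i * e j) = -(e i * (e i * e j) * e j) := by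
        rw [mul_assoc, ← mul_assoc (e j), e_mul_e_of_ne h.symm]; noncomm_ring
    _ = -(e i * e i * (e j * e j)) := by noncomm_ring
    _ = -1 := by simp [e_mul_self, hi, hj]

/-- Bivectors `u * v` and `u * w` sharing one factor anticommute. -/
theorem mul_mul_anticomm_of_anticomm {R : Type*} [Ring R] {u v w : R}
    (huv : v * u = -(u * v)) (huw : w * u = -(u * w)) (hvw : w * v = -(v * w)) :
    u * w * (u * v) = -(u * v * (u * w)) := by
  calc u * w * (u * v) = u * (w * u) * v := by noncomm_ring
    _ = -(u * u * (w * v)) := by rw [huw]; noncomm_ring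
    _ = u * u * (v * w) := by rw [hvw]; noncomm_ring
    _ = -(u * (v * u) * w) := by rw [huv]; noncomm_ring
    _ = -(u * v * (u * w)) := by noncomm_ring

theorem quaternion_mul_conj {A : Type*} [Ring A] [Algebra ℝ A] {i j k : A}
    (hi : i * i = -1) (hj : j * j = -1) (hk : k * k = -1)
    (hji : j * i = -(i * j)) (hki : k * i = -(i * k)) (hkj : k * j = -(j * k))
    (a b c d : ℝ) :
    (a • (1 : A) + b • i + c • j + d • k) * (a • (1 : A) - b • i - c • j - d • k)
      = (a ^ 2 + b ^ 2 + c ^ 2 + d ^ 2) • (1 : A) := by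
  simp only [mul_sub, add_mul, smul_mul_smul_comm, hi, hj, hk, hji, hki, hkj, one_mul, mul_one]
  module

/-- Conjugation by `g + (1/2) τ g w`, where `w` squares to zero, commutes with `h = g⁻¹` and
anticommutes with `τ` and `ξ`. -/
theorem rigid_motion_conj {A : Type*} [Ring A] [Algebra ℝ A] {g h τ ξ w : A}
    (hw : w * w = 0) (hgh : g * h = 1) (hwh : Commute w h)
    (hwτ : w * τ = -(τ * w)) (hwξ : w * ξ = -(ξ * w)) :
    (g + (1 / 2 : ℝ) • (τ * g * w)) * (1 + ξ * w) * (h + (1 / 2 : ℝ) • (h * τ * w))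
      = 1 + (g * ξ * h + τ) * w := by
  have hwhτ : w * (h * τ * w) = 0 := by
    rw [← mul_assoc, ← mul_assoc, hwh.eq, mul_assoc h, hwτ, mul_neg, neg_mul, mul_assoc h,
      mul_assoc τ, hw, mul_zero, mul_zero, neg_zero]
  have hwξw : w * (ξ * w) = 0 := by
    rw [← mul_assoc, hwξ, neg_mul, mul_assoc, hw, mul_zero, neg_zero]
  have left : (g + (1 / 2 : ℝ) • (τ * g * w)) * (1 + ξ * w)
      = g + (g * ξ + (1 / 2 : ℝ) • (τ * g)) * w := by
    rw [mul_add, mul_one, add_mul, smul_mul_assoc, mul_assoc (τ * g), hwξw, add_mul,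
      smul_mul_assoc, mul_zero, smul_zero, add_zero, mul_assoc g]
    abel
  have hghτ : g * (h * τ * w) = τ * w := by rw [← mul_assoc, ← mul_assoc, hgh, one_mul]
  have hτgh : τ * g * (h * w) = τ * w := by
    rw [mul_assoc, ← mul_assoc g, hgh, one_mul]
  have right : (g + (g * ξ + (1 / 2 : ℝ) • (τ * g)) * w) * (h * τ * w) = τ * w := by
    rw [add_mul, hghτ, mul_assoc _ w, hwhτ, mul_zero, add_zero]
  rw [left, mul_add, mul_smul_comm, right, add_mul, hgh, mul_assoc _ w, hwh.eq, add_mul,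
    smul_mul_assoc, hτgh, ← mul_assoc, add_mul]
  module

/-- The double-cover identity for proper rigid motions in `Cl₀,₃,₁`: for a unit
quaternion `g` and translation vector `t`, conjugating `1 + ξ·e₄` by
`g + (1/2)·τ·g·e₄` implements the rigid motion `ξ ↦ g·ξ·star g + τ`. -/
theorem stmt18 (c₀ c₁ c₂ c₃ : ℝ) (hc : c₀ ^ 2 + c₁ ^ 2 + c₂ ^ 2 + c₃ ^ 2 = 1)
    (t x : Fin 4 → ℝ) (ht : t 3 = 0) (hx : x 3 = 0)
    (g : CliffordAlgebra Q4)
    (hg : g = c₀ • (1 : CliffordAlgebra Q4) + c₁ • (e 1 * e 2) + c₂ • (e 0 * e 2)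
        + c₃ • (e 0 * e 1)) :
    (g + (1 / 2 : ℝ) • (ι Q4 t * g * e 3)) * (1 + ι Q4 x * e 3) *
        cstar (g - (1 / 2 : ℝ) • (ι Q4 t * g * e 3))
      = 1 + (g * ι Q4 x * cstar g + ι Q4 t) * e 3 := by
  have hstar : cstar g = c₀ • (1 : CliffordAlgebra Q4) - c₁ • (e 1 * e 2) - c₂ • (e 0 * e 2)
      - c₃ • (e 0 * e 1) := by
    rw [hg]
    simp only [cstar_add, cstar_smul, cstar_one, cstar_e_mul_e (show (1 : Fin 4) ≠ 2 by decide),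
      cstar_e_mul_e (show (0 : Fin 4) ≠ 2 by decide),
      cstar_e_mul_e (show (0 : Fin 4) ≠ 1 by decide)]
    module
  have h10 : e 1 * e 0 = -(e 0 * e 1) := e_mul_e_of_ne (by decide)
  have h20 : e 2 * e 0 = -(e 0 * e 2) := e_mul_e_of_ne (by decide)
  have h21 : e 2 * e 1 = -(e 1 * e 2) := e_mul_e_of_ne (by decide)
  have h12 : e 1 * e 2 = -(e 2 * e 1) := e_mul_e_of_ne (by decide)
  have hji : e 0 * e 2 * (e 1 * e 2) = -(e 1 * e 2 * (e 0 * e 2)) := by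
    have := mul_mul_anticomm_of_anticomm (u := e 2) (v := e 1) (w := e 0)
      h12 (e_mul_e_of_ne (by decide)) (e_mul_e_of_ne (by decide))
    simpa only [h20, h21, neg_mul_neg] using this
  have hki : e 0 * e 1 * (e 1 * e 2) = -(e 1 * e 2 * (e 0 * e 1)) := by
    have := mul_mul_anticomm_of_anticomm (u := e 1) (v := e 2) (w := e 0)
      h21 (e_mul_e_of_ne (by decide)) (e_mul_e_of_ne (by decide))
    simpa only [h10, neg_mul, mul_neg, neg_inj] using this
  have hkj : e 0 * e 1 * (e 0 * e 2) = -(e 0 * e 2 * (e 0 * e 1)) :=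
    mul_mul_anticomm_of_anticomm h20 h10 h12
  have hgh : g * cstar g = 1 := by
    rw [hstar, hg, quaternion_mul_conj (e_mul_e_sq (by decide) (by decide) (by decide))
      (e_mul_e_sq (by decide) (by decide) (by decide))
      (e_mul_e_sq (by decide) (by decide) (by decide)) hji hki hkj, hc, one_smul]
  have hi : Commute (e 3) (e 1 * e 2) := e_three_commute_e_mul_e (by decide) (by decide)
  have hj : Commute (e 3) (e 0 * e 2) := e_three_commute_e_mul_e (by decide) (by decide)
  have hk : Commute (e 3) (e 0 * e 1) := e_three_commute_e_mul_e (by decide) (by decide)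
  have h1 : Commute (e 3) 1 := Commute.one_right _
  have hwh : Commute (e 3) (cstar g) := by
    rw [hstar]
    exact (((h1.smul_right c₀).sub_right (hi.smul_right c₁)).sub_right
      (hj.smul_right c₂)).sub_right (hk.smul_right c₃)
  have hconj : cstar (g - (1 / 2 : ℝ) • (ι Q4 t * g * e 3))
      = cstar g + (1 / 2 : ℝ) • (cstar g * ι Q4 t * e 3) := by
    have h : e 3 * (cstar g * ι Q4 t) = -(cstar g * ι Q4 t * e 3) := by
      rw [← mul_assoc, hwh.eq, mul_assoc, e_three_mul_ι t, mul_neg, mul_assoc]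
    simp only [cstar_sub, cstar_smul, cstar_mul, cstar_e, cstar_ι, mul_neg, neg_mul, neg_neg, h,
      smul_neg, sub_neg_eq_add]
  rw [hconj]
  exact rigid_motion_conj (by simp [e_mul_self]) hgh hwh (e_three_mul_ι t)
    (e_three_mul_ι x)

end
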